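/- Suppose Γ is finite and let T be a family of forward complete trajectories of the switched system ẋ = f(x,σ) such that σ ∈ S_e ∩ S_d for every (x,σ) ∈ T. Suppose there exists an F-weak Lyapunov pair (V,W) for T such that for every γ ∈ Γ either O_γ^b(f_γ,W_γ) = E_γ ∩ O_γ or O_γ^f(f_γ,W_γ) = E_γ ∩ O_γ, and such that ∩_{γ∈Γ} (E_γ ∩ O_γ) = {0}. Then T is locally asymptotically stable (LAS). If, in addition, O = ℝⁿ and V is radially unbounded, then T is globally asymptotically stable (GAS). -/

import Mathlib

open Filter Topology MeasureTheory Set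

noncomputable section

abbrev Eucl (n : ℕ) : Type := EuclideanSpace ℝ (Fin n)

/-- The set of discontinuity (switching) times of a signal. -/
def JumpTimes {Γ : Type*} [TopologicalSpace Γ] (σ : ℝ → Γ) : Set ℝ :=
  {t | ¬ ContinuousAt σ t}

/-- A switching signal: piecewise constant (finitely many discontinuities in every
compact interval, locally constant to the right and on a left punctured neighborhood
of every point) and continuous from the right. -/
structure IsSwitchingSignal {Γ : Type*} [TopologicalSpace Γ] (σ : ℝ → Γ) : Prop where
  locFinite : ∀ a b : ℝ, (JumpTimes σ ∩ Set.Icc a b).Finite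
  rightConst : ∀ t : ℝ, ∃ ε > (0:ℝ), ∀ s ∈ Set.Ico t (t + ε), σ s = σ t
  leftConst : ∀ t : ℝ, ∃ ε > (0:ℝ), ∀ s ∈ Set.Ioo (t - ε) t, ∀ s' ∈ Set.Ioo (t - ε) t, σ s = σ s'

/-- `SA Γ τD N₀` : switching signals with average dwell time `τD` and chatter bound `N₀`. -/
def SA (Γ : Type*) [TopologicalSpace Γ] (τD : ℝ) (N₀ : ℕ) : Set (ℝ → Γ) :=
  {σ | IsSwitchingSignal σ ∧ ∀ τ₁ τ₂ : ℝ, τ₁ < τ₂ →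
    ((JumpTimes σ ∩ Set.Ioo τ₁ τ₂).ncard : ℝ) ≤ (N₀ : ℝ) + (τ₂ - τ₁) / τD}

def SAall (Γ : Type*) [TopologicalSpace Γ] : Set (ℝ → Γ) :=
  ⋃ τD ∈ Set.Ioi (0 : ℝ), ⋃ N₀ : ℕ, SA Γ τD N₀

/-- Dwell-time signals. -/
def SD (Γ : Type*) [TopologicalSpace Γ] (τD : ℝ) : Set (ℝ → Γ) := SA Γ τD 1

def SDall (Γ : Type*) [TopologicalSpace Γ] : Set (ℝ → Γ) :=
  ⋃ τD ∈ Set.Ioi (0 : ℝ), SD Γ τD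

/-- First switching time strictly greater than `t` (`⊤` if none). -/
def tau1 {Γ : Type*} [TopologicalSpace Γ] (σ : ℝ → Γ) (t : ℝ) : EReal :=
  sInf (Real.toEReal '' (JumpTimes σ ∩ Set.Ioi t))

/-- The class `S^H` of switching signals compatible with the set-valued map `H`:
at each switching time the new value belongs to `H` of the left limit. -/
def SH {Γ : Type*} [TopologicalSpace Γ] (H : Γ → Set Γ) : Set (ℝ → Γ) :=
  {σ | ∀ t ∈ JumpTimes σ, ∀ γ' : Γ,
    Filter.Tendsto σ (nhdsWithin t (Set.Iio t)) (nhds γ') → σ t ∈ H γ'}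

/-- The "ergodic" class `S_e[T]`. -/
def SE (Γ : Type*) [TopologicalSpace Γ] (T : ℝ) : Set (ℝ → Γ) :=
  {σ | ∀ t₀ : ℝ, 0 ≤ t₀ → ∀ γ : Γ, ∃ t ∈ Set.Icc t₀ (t₀ + T), σ t = γ}

def SEall (Γ : Type*) [TopologicalSpace Γ] : Set (ℝ → Γ) :=
  ⋃ T ∈ Set.Ioi (0 : ℝ), SE Γ T

/-- Property P of a family of switching signals. -/
def HasPropertyP {Γ : Type*} [TopologicalSpace Γ] (S : Set (ℝ → Γ)) : Prop :=
  (∃ τD > (0 : ℝ), ∃ N₀ : ℕ, S ⊆ SA Γ τD N₀) ∧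
  (∀ σ ∈ S, ∀ s > (0 : ℝ), (fun t => σ (t + s)) ∈ S) ∧
  (∀ σseq : ℕ → ℝ → Γ, (∀ k, σseq k ∈ S) →
    ∃ σstar ∈ S, ∃ φ : ℕ → ℕ, StrictMono φ ∧
      ∀ᵐ t ∂(volume : Measure ℝ),
        Filter.Tendsto (fun l => σseq (φ l) t) Filter.atTop (nhds (σstar t)))

/-- A solution of `ẋ = g(x)` with values in `X`, on the set `I`. -/
def IsSolOn {n : ℕ} (g : Eucl n → Eucl n) (X : Set (Eucl n)) (φ : ℝ → Eucl n) (I : Set ℝ) : Prop :=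
  ContinuousOn φ I ∧ (∀ t ∈ I, φ t ∈ X) ∧
  ∀ t₀ ∈ I, ∀ t ∈ I,
    IntervalIntegrable (fun s => g (φ s)) volume t₀ t ∧
    φ t = φ t₀ + ∫ s in t₀..t, g (φ s)

/-- A trajectory of the switched system `ẋ = f(x,σ)` on the interval `I`. -/
structure IsTrajectory {n : ℕ} {Γ : Type*} [TopologicalSpace Γ]
    (f : Eucl n × Γ → Eucl n) (domf : Set (Eucl n × Γ))
    (x : ℝ → Eucl n) (σ : ℝ → Γ) (I : Set ℝ) : Prop where
  signal : IsSwitchingSignal σ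
  nonempty : I.Nonempty
  ordConn : I.OrdConnected
  cont : ContinuousOn x I
  mem : ∀ t ∈ I, (x t, σ t) ∈ domf
  intg : ∀ t₀ ∈ I, ∀ t ∈ I,
    IntervalIntegrable (fun s => f (x s, σ s)) volume t₀ t ∧
    x t = x t₀ + ∫ s in t₀..t, f (x s, σ s)

/-- Precompactness of a trajectory relative to `O`. -/
def PrecompactRel {n : ℕ} (x : ℝ → Eucl n) (I : Set ℝ) (O : Set (Eucl n)) : Prop :=
  ∃ B : Set (Eucl n), B ⊆ O ∧ IsCompact B ∧ ∀ t ∈ I, x t ∈ B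

/-- ω-limit set of `x` defined on `I`. -/
def OmegaLimit {n : ℕ} (x : ℝ → Eucl n) (I : Set ℝ) : Set (Eucl n) :=
  {ξ | ∃ s : ℕ → ℝ, StrictMono s ∧ (∀ k, s k ∈ I) ∧
    Filter.Tendsto s Filter.atTop Filter.atTop ∧
    Filter.Tendsto (fun k => x (s k)) Filter.atTop (nhds ξ)}

/-- The set `Ω♯(x,σ)`. -/
def OmegaSharp {n : ℕ} {Γ : Type*} [TopologicalSpace Γ] (x : ℝ → Eucl n) (σ : ℝ → Γ) :
    Set (Eucl n × Γ) :=
  {p | ∃ s : ℕ → ℝ, StrictMono s ∧ (∀ k, 0 ≤ s k) ∧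
    Filter.Tendsto s Filter.atTop Filter.atTop ∧
    (∃ r : EReal, 0 < r ∧
      Filter.Tendsto (fun k => tau1 σ (s k) - Real.toEReal (s k)) Filter.atTop (nhds r)) ∧
    Filter.Tendsto (fun k => x (s k)) Filter.atTop (nhds p.1) ∧
    Filter.Tendsto (fun k => σ (s k)) Filter.atTop (nhds p.2)}

/-- Weak invariance of `M` w.r.t. the family of complete trajectories `T`
(without the nonemptiness requirement). -/
def WeaklyInvariantCore {n : ℕ} {Γ : Type*} (T : Set ((ℝ → Eucl n) × (ℝ → Γ)))
    (M : Set (Eucl n × Γ)) : Prop :=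
  ∀ p ∈ M, ∃ xs ∈ T, xs.1 0 = p.1 ∧ xs.2 0 = p.2 ∧ ∀ t : ℝ, (xs.1 t, xs.2 t) ∈ M

/-- Weak invariance of a nonempty set `M` w.r.t. `T`. -/
def WeaklyInvariant {n : ℕ} {Γ : Type*} (T : Set ((ℝ → Eucl n) × (ℝ → Γ)))
    (M : Set (Eucl n × Γ)) : Prop :=
  M.Nonempty ∧ WeaklyInvariantCore T M

/-- Maximal weakly invariant subset of `S` w.r.t. `T`. -/
def MaxWeaklyInvariantIn {n : ℕ} {Γ : Type*} (T : Set ((ℝ → Eucl n) × (ℝ → Γ)))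
    (S : Set (Eucl n × Γ)) : Set (Eucl n × Γ) :=
  ⋃₀ {M | M ⊆ S ∧ WeaklyInvariantCore T M}

/-- All complete trajectories whose switching signal lies in `S`. -/
def TrajOf {n : ℕ} {Γ : Type*} [TopologicalSpace Γ] (f : Eucl n × Γ → Eucl n)
    (domf : Set (Eucl n × Γ)) (S : Set (ℝ → Γ)) : Set ((ℝ → Eucl n) × (ℝ → Γ)) :=
  {xs | IsTrajectory f domf xs.1 xs.2 Set.univ ∧ xs.2 ∈ S}

/-- `x → M` : convergence of `x(t)` to the set `M` as `t → +∞`. -/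
def ConvergesTo {n : ℕ} (x : ℝ → Eucl n) (M : Set (Eucl n)) : Prop :=
  Filter.Tendsto (fun t => Metric.infDist (x t) M) Filter.atTop (nhds 0)

def Oset {n : ℕ} {Γ : Type*} (domV : Set (Eucl n × Γ)) : Set (Eucl n) := Prod.fst '' domV

def Ogamma {n : ℕ} {Γ : Type*} (domV domf : Set (Eucl n × Γ)) (γ : Γ) : Set (Eucl n) :=
  {ξ | ξ ∈ Oset domV ∧ (ξ, γ) ∈ domf}

/-- The class 𝒱 of functions. -/
structure ClassVFun {n : ℕ} {Γ : Type*} (V : Eucl n × Γ → ℝ)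
    (domV domf : Set (Eucl n × Γ)) : Prop where
  openD : ∀ γ : Γ, IsOpen {ξ : Eucl n | (ξ, γ) ∈ domV}
  subD : ∀ γ : Γ, ∀ ξ ∈ Ogamma domV domf γ, (ξ, γ) ∈ domV
  diff : ∀ γ : Γ, ∀ ξ ∈ Ogamma domV domf γ, DifferentiableAt ℝ (fun ξ' => V (ξ', γ)) ξ

/-- The set `Z_V`. -/
def ZV {n : ℕ} {Γ : Type*} (f : Eucl n × Γ → Eucl n) (V : Eucl n × Γ → ℝ)
    (domV domf : Set (Eucl n × Γ)) : Set (Eucl n × Γ) :=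
  {p | p ∈ domf ∧ p.1 ∈ Oset domV ∧ fderiv ℝ (fun ξ' => V (ξ', p.2)) p.1 (f p) = 0}

/-- Assumption (A1). -/
structure AssumptionA1 {n : ℕ} {Γ : Type*} [TopologicalSpace Γ]
    (domf : Set (Eucl n × Γ)) (V : Eucl n × Γ → ℝ) (domV : Set (Eucl n × Γ))
    (x : ℝ → Eucl n) (σ : ℝ → Γ) (I : Set ℝ) : Prop where
  classV : ClassVFun V domV domf
  contV : ContinuousOn V (domf ∩ (Oset domV ×ˢ (Set.univ : Set Γ)))
  precompact : PrecompactRel x I (Oset domV)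
  nonincr : AntitoneOn (fun t => V (x t, σ t)) (Set.Ici 0)

/-- Assumption (A2) (for finite Γ). -/
structure AssumptionA2 {n : ℕ} {Γ : Type*} [TopologicalSpace Γ]
    (domf : Set (Eucl n × Γ)) (V : Eucl n × Γ → ℝ) (domV : Set (Eucl n × Γ))
    (x : ℝ → Eucl n) (σ : ℝ → Γ) (I : Set ℝ) : Prop where
  classV : ClassVFun V domV domf
  precompact : PrecompactRel x I (Oset domV)
  nonincr : ∀ γ : Γ, AntitoneOn (fun t => V (x t, σ t)) ({t | σ t = γ} ∩ Set.Ici 0)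

/-- The inequality `−∇V_γ(ξ)·f_γ(ξ) ≥ W_γ(ξ) ≥ 0` on each `O_γ`. -/
def Wineq {n : ℕ} {Γ : Type*} (f : Eucl n × Γ → Eucl n) (V W : Eucl n × Γ → ℝ)
    (domV domf : Set (Eucl n × Γ)) : Prop :=
  ∀ γ : Γ, ∀ ξ ∈ Ogamma domV domf γ,
    W (ξ, γ) ≤ -(fderiv ℝ (fun ξ' => V (ξ', γ)) ξ (f (ξ, γ))) ∧ 0 ≤ W (ξ, γ)

/-- Assumption (A4). -/
structure AssumptionA4 {n : ℕ} {Γ : Type*} [TopologicalSpace Γ] (f : Eucl n × Γ → Eucl n)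
    (domf : Set (Eucl n × Γ)) (V : Eucl n × Γ → ℝ) (domV : Set (Eucl n × Γ))
    (W : Eucl n × Γ → ℝ) (x : ℝ → Eucl n) (σ : ℝ → Γ) (I : Set ℝ) : Prop where
  classV : ClassVFun V domV domf
  boundedV : ∀ K : Set (Eucl n × Γ), K ⊆ domf ∩ (Oset domV ×ˢ (Set.univ : Set Γ)) →
    IsCompact K → ∃ M : ℝ, ∀ p ∈ K, |V p| ≤ M
  precompact : PrecompactRel x I (Oset domV)
  nonincr : AntitoneOn (fun t => V (x t, σ t)) (Set.Ici 0)
  wineq : Wineq f V W domV domf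
  contW : ContinuousOn W (domf ∩ (Oset domV ×ˢ (Set.univ : Set Γ)))

/-- The set `X^f(g,h,τ)` for finite `τ`. -/
def XFwd {n : ℕ} (X : Set (Eucl n)) (g : Eucl n → Eucl n) (h : Eucl n → ℝ) (τ : ℝ) :
    Set (Eucl n) :=
  {ξ | ∃ φ : ℝ → Eucl n, IsSolOn g X φ (Set.Icc 0 τ) ∧ φ 0 = ξ ∧
    ∀ t ∈ Set.Icc (0 : ℝ) τ, h (φ t) = 0}

/-- The set `X^b(g,h,τ)` for finite `τ`. -/
def XBwd {n : ℕ} (X : Set (Eucl n)) (g : Eucl n → Eucl n) (h : Eucl n → ℝ) (τ : ℝ) :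
    Set (Eucl n) :=
  {ξ | ∃ φ : ℝ → Eucl n, IsSolOn g X φ (Set.Icc (-τ) 0) ∧ φ 0 = ξ ∧
    ∀ t ∈ Set.Icc (-τ) (0 : ℝ), h (φ t) = 0}

/-- The set `X^f(g,h,∞)`. -/
def XFwdInf {n : ℕ} (X : Set (Eucl n)) (g : Eucl n → Eucl n) (h : Eucl n → ℝ) :
    Set (Eucl n) :=
  {ξ | ∃ φ : ℝ → Eucl n, IsSolOn g X φ (Set.Ici 0) ∧ φ 0 = ξ ∧
    ∀ t ∈ Set.Ici (0 : ℝ), h (φ t) = 0}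

/-- The set `X^b(g,h,∞)`. -/
def XBwdInf {n : ℕ} (X : Set (Eucl n)) (g : Eucl n → Eucl n) (h : Eucl n → ℝ) :
    Set (Eucl n) :=
  {ξ | ∃ φ : ℝ → Eucl n, IsSolOn g X φ (Set.Iic 0) ∧ φ 0 = ξ ∧
    ∀ t ∈ Set.Iic (0 : ℝ), h (φ t) = 0}

/-- `X^f(g,h) = ∪_{τ>0} X^f(g,h,τ)`. -/
def XFwdFin {n : ℕ} (X : Set (Eucl n)) (g : Eucl n → Eucl n) (h : Eucl n → ℝ) :
    Set (Eucl n) :=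
  ⋃ τ ∈ Set.Ioi (0 : ℝ), XFwd X g h τ

/-- `X^b(g,h) = ∪_{τ>0} X^b(g,h,τ)`. -/
def XBwdFin {n : ℕ} (X : Set (Eucl n)) (g : Eucl n → Eucl n) (h : Eucl n → ℝ) :
    Set (Eucl n) :=
  ⋃ τ ∈ Set.Ioi (0 : ℝ), XBwd X g h τ

/-- Weakly meagre functions on `[0,∞)`. -/
def WeaklyMeagre (y : ℝ → ℝ) : Prop :=
  ∀ I : ℕ → Set ℝ, (∀ k, (I k).Nonempty) → (∀ k, I k ⊆ Set.Ici 0) →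
    (∀ k, (I k).OrdConnected) → (Pairwise fun k l => Disjoint (I k) (I l)) →
    (∃ δ : ENNReal, 0 < δ ∧ ∀ k, δ ≤ volume (I k)) →
    Filter.Tendsto (fun k => sInf ((fun t => |y t|) '' I k)) Filter.atTop (nhds 0)

/-- Assumption (E0) : the origin is an equilibrium point of the switched system. -/
def AssumpE0 {n : ℕ} {Γ : Type*} (f : Eucl n × Γ → Eucl n) (domf : Set (Eucl n × Γ)) : Prop :=
  ∀ γ : Γ, ((0 : Eucl n), γ) ∈ domf → f (0, γ) = 0

/-- Assumption (U) : uniqueness of the solution of the IVP `ẋ = f_γ(x)`, `x(0)=0`. -/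
def AssumpU {n : ℕ} {Γ : Type*} (f : Eucl n × Γ → Eucl n) (domf : Set (Eucl n × Γ)) : Prop :=
  ∀ γ : Γ, ((0 : Eucl n), γ) ∈ domf →
    ∀ I : Set ℝ, I.OrdConnected → (0 : ℝ) ∈ I →
    ∀ φ ψ : ℝ → Eucl n,
      IsSolOn (fun ξ => f (ξ, γ)) {ξ | (ξ, γ) ∈ domf} φ I →
      IsSolOn (fun ξ => f (ξ, γ)) {ξ | (ξ, γ) ∈ domf} ψ I →
      φ 0 = 0 → ψ 0 = 0 → ∀ t ∈ I, φ t = ψ t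

/-- The set `E_γ` of equilibrium points of `f_γ`. -/
def Egamma {n : ℕ} {Γ : Type*} (f : Eucl n × Γ → Eucl n) (domf : Set (Eucl n × Γ)) (γ : Γ) :
    Set (Eucl n) :=
  {ξ | (ξ, γ) ∈ domf ∧ f (ξ, γ) = 0}

/-- Discrete subsets of `ℝⁿ`. -/
def IsDiscreteSet {n : ℕ} (S : Set (Eucl n)) : Prop :=
  ∀ ξ ∈ S, ∃ ε > (0 : ℝ), S ∩ Metric.ball ξ ε = {ξ}

/-- Class-K functions (on `[0,∞)`). -/
structure ClassK (α : ℝ → ℝ) : Prop where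
  cont : ContinuousOn α (Set.Ici 0)
  mono : StrictMonoOn α (Set.Ici 0)
  zero : α 0 = 0

/-- Class-K∞ functions. -/
structure ClassKInf (α : ℝ → ℝ) extends ClassK α : Prop where
  unbounded : Filter.Tendsto α Filter.atTop Filter.atTop

/-- Local uniform stability of a family of forward complete trajectories. -/
def FamilyLUS {n : ℕ} {Γ : Type*} (T : Set ((ℝ → Eucl n) × (ℝ → Γ))) : Prop :=
  ∃ r > (0 : ℝ), ∃ α : ℝ → ℝ, ClassK α ∧
    ∀ xs ∈ T, ∀ t₀ : ℝ, 0 ≤ t₀ → ‖xs.1 t₀‖ ≤ r → ∀ t : ℝ, t₀ ≤ t → ‖xs.1 t‖ ≤ α ‖xs.1 t₀‖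

/-- Global uniform stability. -/
def FamilyGUS {n : ℕ} {Γ : Type*} (T : Set ((ℝ → Eucl n) × (ℝ → Γ))) : Prop :=
  ∃ α : ℝ → ℝ, ClassKInf α ∧
    ∀ xs ∈ T, ∀ t₀ : ℝ, 0 ≤ t₀ → ∀ t : ℝ, t₀ ≤ t → ‖xs.1 t‖ ≤ α ‖xs.1 t₀‖

/-- Local asymptotic stability. -/
def FamilyLAS {n : ℕ} {Γ : Type*} (T : Set ((ℝ → Eucl n) × (ℝ → Γ))) : Prop :=
  FamilyLUS T ∧ ∃ η > (0 : ℝ), ∀ xs ∈ T, ‖xs.1 0‖ < η →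
    Filter.Tendsto xs.1 Filter.atTop (nhds 0)

/-- Global asymptotic stability. -/
def FamilyGAS {n : ℕ} {Γ : Type*} (T : Set ((ℝ → Eucl n) × (ℝ → Γ))) : Prop :=
  FamilyGUS T ∧ ∀ xs ∈ T, Filter.Tendsto xs.1 Filter.atTop (nhds 0)

/-- A weak Lyapunov pair `(V,W)` for the family `T`. -/
structure WeakLyapunovPair {n : ℕ} {Γ : Type*} [TopologicalSpace Γ]
    (f : Eucl n × Γ → Eucl n) (domf : Set (Eucl n × Γ)) (V : Eucl n × Γ → ℝ)
    (domV : Set (Eucl n × Γ)) (W : Eucl n × Γ → ℝ)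
    (T : Set ((ℝ → Eucl n) × (ℝ → Γ))) : Prop where
  classV : ClassVFun V domV domf
  zeroMem : (0 : Eucl n) ∈ Oset domV
  bounds : ∃ α₁ α₂ : ℝ → ℝ, ClassK α₁ ∧ ClassK α₂ ∧
    ∀ γ : Γ, ∀ ξ ∈ Ogamma domV domf γ, α₁ ‖ξ‖ ≤ V (ξ, γ) ∧ V (ξ, γ) ≤ α₂ ‖ξ‖
  wineq : Wineq f V W domV domf
  decreasing : ∀ xs ∈ T, ∀ a b : ℝ, 0 ≤ a → a ≤ b →
    (∀ t ∈ Set.Icc a b, xs.1 t ∈ Oset domV) →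
    AntitoneOn (fun t => V (xs.1 t, xs.2 t)) (Set.Icc a b)

/-- An F-weak Lyapunov pair `(V,W)` for the family `T`. -/
structure FWeakLyapunovPair {n : ℕ} {Γ : Type*} [TopologicalSpace Γ]
    (f : Eucl n × Γ → Eucl n) (domf : Set (Eucl n × Γ)) (V : Eucl n × Γ → ℝ)
    (domV : Set (Eucl n × Γ)) (W : Eucl n × Γ → ℝ)
    (T : Set ((ℝ → Eucl n) × (ℝ → Γ))) : Prop where
  classV : ClassVFun V domV domf
  zeroMem : (0 : Eucl n) ∈ Oset domV
  bounds : ∃ α₁ α₂ : ℝ → ℝ, ClassK α₁ ∧ ClassK α₂ ∧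
    ∀ γ : Γ, ∀ ξ ∈ Ogamma domV domf γ, α₁ ‖ξ‖ ≤ V (ξ, γ) ∧ V (ξ, γ) ≤ α₂ ‖ξ‖
  wineq : Wineq f V W domV domf
  decreasing : ∀ xs ∈ T, ∀ a b : ℝ, 0 ≤ a → a ≤ b →
    (∀ t ∈ Set.Icc a b, xs.1 t ∈ Oset domV) →
    ∀ γ : Γ, AntitoneOn (fun t => V (xs.1 t, γ)) (Set.Icc a b ∩ {t | xs.2 t = γ})

/-- `V` is radially unbounded : the class-K bounds may be chosen of class K∞. -/
def RadiallyUnbounded {n : ℕ} {Γ : Type*} (V : Eucl n × Γ → ℝ)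
    (domV domf : Set (Eucl n × Γ)) : Prop :=
  ∃ α₁ α₂ : ℝ → ℝ, ClassKInf α₁ ∧ ClassKInf α₂ ∧
    ∀ γ : Γ, ∀ ξ ∈ Ogamma domV domf γ, α₁ ‖ξ‖ ≤ V (ξ, γ) ∧ V (ξ, γ) ≤ α₂ ‖ξ‖

/-- Simple cycle `{γ_i}_{i=1}^m` of the set-valued map `H`. -/
def IsSimpleCycle {Γ : Type*} (H : Γ → Set Γ) (m : ℕ) (γs : ℕ → Γ) : Prop :=
  3 ≤ m ∧ γs 1 = γs m ∧ (∀ i, 1 ≤ i → i < m → γs (i + 1) ∈ H (γs i)) ∧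
  ∀ i j, 1 ≤ i → i < j → j ≤ m → γs i = γs j → i = 1 ∧ j = m

/-- A family of forward complete trajectories of the switched system. -/
def ForwardCompleteFamily {n : ℕ} {Γ : Type*} [TopologicalSpace Γ]
    (f : Eucl n × Γ → Eucl n) (domf : Set (Eucl n × Γ))
    (T : Set ((ℝ → Eucl n) × (ℝ → Γ))) : Prop :=
  ∀ xs ∈ T, ∃ I : Set ℝ, Set.Ici (0 : ℝ) ⊆ I ∧ IsTrajectory f domf xs.1 xs.2 I

/-- Condition (a) : `O_γ^f(f_γ,W_γ,∞) ∩ O_γ^b(f_γ,W_γ,∞) ⊆ {0}` for every `γ`. -/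
def CondA {n : ℕ} {Γ : Type*} (f : Eucl n × Γ → Eucl n)
    (domf domV : Set (Eucl n × Γ)) (W : Eucl n × Γ → ℝ) : Prop :=
  ∀ γ : Γ, XFwdInf (Ogamma domV domf γ) (fun ξ => f (ξ, γ)) (fun ξ => W (ξ, γ)) ∩
    XBwdInf (Ogamma domV domf γ) (fun ξ => f (ξ, γ)) (fun ξ => W (ξ, γ)) ⊆ {0}

/-- Condition (b) : `O_γ^b(f_γ,W_γ) ∩ O_{γ'}^f(f_{γ'},W_{γ'}) ⊆ {0}` for `γ ≠ γ'`. -/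
def CondB {n : ℕ} {Γ : Type*} (f : Eucl n × Γ → Eucl n)
    (domf domV : Set (Eucl n × Γ)) (W : Eucl n × Γ → ℝ) : Prop :=
  ∀ γ γ' : Γ, γ ≠ γ' →
    XBwdFin (Ogamma domV domf γ) (fun ξ => f (ξ, γ)) (fun ξ => W (ξ, γ)) ∩
    XFwdFin (Ogamma domV domf γ') (fun ξ => f (ξ, γ')) (fun ξ => W (ξ, γ')) ⊆ {0}

/-- Condition (b') : the variant of (b) involving the level sets of `V`. -/
def CondB' {n : ℕ} {Γ : Type*} (f : Eucl n × Γ → Eucl n) (V : Eucl n × Γ → ℝ)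
    (domf domV : Set (Eucl n × Γ)) (W : Eucl n × Γ → ℝ) : Prop :=
  ∀ γ γ' : Γ, γ ≠ γ' → ∀ c : ℝ,
    XBwdFin (Ogamma domV domf γ) (fun ξ => f (ξ, γ)) (fun ξ => W (ξ, γ)) ∩
    XFwdFin (Ogamma domV domf γ') (fun ξ => f (ξ, γ')) (fun ξ => W (ξ, γ')) ∩
    {ξ : Eucl n | V (ξ, γ) = c} ∩ {ξ : Eucl n | V (ξ, γ') = c} ⊆ {0}

/-- Condition (i) of the cycle theorems :
either all the forward infinite-horizon sets, or all the backward ones, reduce to `{0}`. -/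
def CondI {n : ℕ} {Γ : Type*} (f : Eucl n × Γ → Eucl n)
    (domf domV : Set (Eucl n × Γ)) (W : Eucl n × Γ → ℝ) : Prop :=
  (∀ γ : Γ, XFwdInf (Ogamma domV domf γ) (fun ξ => f (ξ, γ)) (fun ξ => W (ξ, γ)) ⊆ {0}) ∨
  (∀ γ : Γ, XBwdInf (Ogamma domV domf γ) (fun ξ => f (ξ, γ)) (fun ξ => W (ξ, γ)) ⊆ {0})

/-- Condition (ii) on simple cycles of `H`. -/
def CondCycle {n : ℕ} {Γ : Type*} (f : Eucl n × Γ → Eucl n)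
    (domf domV : Set (Eucl n × Γ)) (W : Eucl n × Γ → ℝ) (H : Γ → Set Γ) : Prop :=
  ∀ m : ℕ, ∀ γs : ℕ → Γ, IsSimpleCycle H m γs →
    ∃ j : ℕ, 1 ≤ j ∧ j < m ∧
      XBwdFin (Ogamma domV domf (γs j)) (fun ξ => f (ξ, γs j)) (fun ξ => W (ξ, γs j)) ∩
      XFwdFin (Ogamma domV domf (γs (j + 1))) (fun ξ => f (ξ, γs (j + 1)))
        (fun ξ => W (ξ, γs (j + 1))) ⊆ {0}

/-- Condition (iii) on simple cycles of `H`, involving the level sets of `V`. -/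
def CondCycle' {n : ℕ} {Γ : Type*} (f : Eucl n × Γ → Eucl n) (V : Eucl n × Γ → ℝ)
    (domf domV : Set (Eucl n × Γ)) (W : Eucl n × Γ → ℝ) (H : Γ → Set Γ) : Prop :=
  ∀ c : ℝ, ∀ m : ℕ, ∀ γs : ℕ → Γ, IsSimpleCycle H m γs →
    ∃ j : ℕ, 1 ≤ j ∧ j < m ∧
      XBwdFin (Ogamma domV domf (γs j)) (fun ξ => f (ξ, γs j)) (fun ξ => W (ξ, γs j)) ∩
      XFwdFin (Ogamma domV domf (γs (j + 1))) (fun ξ => f (ξ, γs (j + 1)))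
        (fun ξ => W (ξ, γs (j + 1))) ∩
      {ξ : Eucl n | V (ξ, γs j) = c} ∩ {ξ : Eucl n | V (ξ, γs (j + 1)) = c} ⊆ {0}

/-- For every `γ`, `O_γ^b(f_γ,W_γ) = E_γ ∩ O_γ` or `O_γ^f(f_γ,W_γ) = E_γ ∩ O_γ`. -/
def CondEquilObs {n : ℕ} {Γ : Type*} (f : Eucl n × Γ → Eucl n)
    (domf domV : Set (Eucl n × Γ)) (W : Eucl n × Γ → ℝ) : Prop :=
  ∀ γ : Γ,
    XBwdFin (Ogamma domV domf γ) (fun ξ => f (ξ, γ)) (fun ξ => W (ξ, γ)) =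
      Egamma f domf γ ∩ Ogamma domV domf γ ∨
    XFwdFin (Ogamma domV domf γ) (fun ξ => f (ξ, γ)) (fun ξ => W (ξ, γ)) =
      Egamma f domf γ ∩ Ogamma domV domf γ

end

/-! ### Comparison functions -/

/-- Intermediate values of class-K∞ functions. -/
lemma ClassKInf.exists_eq {α : ℝ → ℝ} (h : ClassKInf α) {v : ℝ} (hv : 0 ≤ v) :
    ∃ s, 0 ≤ s ∧ α s = v := by
  obtain ⟨b, hb⟩ := ((h.unbounded.eventually_ge_atTop v).and (eventually_ge_atTop 0)).exists
  have := intermediate_value_Icc hb.2 (h.cont.mono (fun x hx => hx.1))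
  obtain ⟨s, hs, hs'⟩ := this ⟨by rw [h.zero]; exact hv, hb.1⟩
  exact ⟨s, hs.1, hs'⟩

lemma ClassK.nonneg {α : ℝ → ℝ} (h : ClassK α) {s : ℝ} (hs : 0 ≤ s) : 0 ≤ α s := by
  have := h.mono.monotoneOn (mem_Ici.2 le_rfl) (mem_Ici.2 hs) hs
  rwa [h.zero] at this

lemma exists_rho {α₁ α₂ : ℝ → ℝ} (h1 : ClassKInf α₁) (h2 : ClassK α₂) :
    ∃ ρ : ℝ → ℝ, StrictMono ρ ∧ Continuous ρ ∧ ρ 0 = 0 ∧ (∀ s, s ≤ ρ s) ∧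
      ∀ a b : ℝ, 0 ≤ a → 0 ≤ b → α₁ a ≤ α₂ b → a ≤ ρ b := by
  have hβ : ClassKInf (fun s => α₂ s + α₁ s) := by
    refine ⟨⟨h2.cont.add h1.cont, fun a ha b hb hab => add_lt_add (h2.mono ha hb hab)
      (h1.mono ha hb hab), by simp [h1.zero, h2.zero]⟩, ?_⟩
    refine tendsto_atTop_mono' _ ?_ h1.unbounded
    filter_upwards [eventually_ge_atTop 0] with s hs
    have := h2.nonneg hs
    linarith
  have hex : ∀ s : ℝ, ∃ r, (0 ≤ s → 0 ≤ r ∧ α₁ r = α₂ s + α₁ s) ∧ (s < 0 → r = s) := by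
    intro s
    rcases le_or_gt 0 s with hs | hs
    · obtain ⟨r, hr, hr'⟩ := h1.exists_eq (hβ.nonneg hs)
      exact ⟨r, fun _ => ⟨hr, hr'⟩, fun h => absurd h (not_lt.2 hs)⟩
    · exact ⟨s, fun h => absurd h (not_le.2 hs), fun _ => rfl⟩
  choose ρ hρ hρ' using hex
  have key : ∀ a b : ℝ, 0 ≤ a → 0 ≤ b → α₁ a ≤ α₂ b + α₁ b → a ≤ ρ b := by
    intro a b ha hb hab
    rw [← (hρ b hb).2] at hab
    exact (h1.mono.le_iff_le (mem_Ici.2 ha) (mem_Ici.2 (hρ b hb).1)).1 hab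
  have hmono : StrictMono ρ := by
    intro s t hst
    rcases lt_or_ge s 0 with hs | hs
    · rw [hρ' s hs]
      rcases lt_or_ge t 0 with ht | ht
      · rw [hρ' t ht]; exact hst
      · exact hs.trans_le (hρ t ht).1
    · have ht : 0 ≤ t := hs.trans hst.le
      have := hβ.mono (mem_Ici.2 hs) (mem_Ici.2 ht) hst
      rw [← (hρ s hs).2, ← (hρ t ht).2] at this
      exact (h1.mono.lt_iff_lt (mem_Ici.2 (hρ s hs).1) (mem_Ici.2 (hρ t ht).1)).1 this
  have hsurj : Function.Surjective ρ := by
    intro r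
    rcases lt_or_ge r 0 with hr | hr
    · exact ⟨r, hρ' r hr⟩
    · obtain ⟨s, hs, hs'⟩ := hβ.exists_eq (h1.nonneg hr)
      refine ⟨s, h1.mono.injOn (mem_Ici.2 (hρ s hs).1) (mem_Ici.2 hr) ?_⟩
      rw [(hρ s hs).2]; exact hs'
  refine ⟨ρ, hmono, hmono.monotone.continuous_of_surjective hsurj, ?_, ?_, ?_⟩
  · refine h1.mono.injOn (mem_Ici.2 (hρ 0 le_rfl).1) (mem_Ici.2 le_rfl) ?_
    rw [(hρ 0 le_rfl).2, h2.zero, zero_add]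
  · intro s
    rcases lt_or_ge s 0 with hs | hs
    · exact (hρ' s hs).ge
    · refine key s s hs hs ?_
      have := h2.nonneg hs
      linarith
  · intro a b ha hb hab
    refine key a b ha hb ?_
    have := h1.nonneg hb
    linarith

lemma exists_extension {α : ℝ → ℝ} (h : ClassK α) {R : ℝ} (hR : 0 < R) :
    ∃ β : ℝ → ℝ, ClassKInf β ∧ ∀ s, s ≤ R → β s = α s := by
  refine ⟨fun s => α (min s R) + (s - min s R), ⟨⟨?_, ?_, ?_⟩, ?_⟩, ?_⟩
  · have hm : Continuous fun s : ℝ => min s R := continuous_id.min continuous_const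
    refine ContinuousOn.add (h.cont.comp hm.continuousOn ?_)
      (continuous_id.sub hm).continuousOn
    intro s hs
    exact le_min hs hR.le
  · intro a ha b hb hab
    simp only
    have ha' : (0:ℝ) ≤ a := ha
    have hb' : (0:ℝ) ≤ b := hb
    rcases le_total b R with hbR | hbR
    · rw [min_eq_left hbR, min_eq_left (hab.le.trans hbR)]
      have := h.mono ha hb hab
      linarith
    · rw [min_eq_right hbR]
      rcases lt_or_ge a R with haR | haR
      · rw [min_eq_left haR.le]
        have := h.mono ha (mem_Ici.2 hR.le) haR
        linarith
      · rw [min_eq_right haR]; linarith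
  · simp [min_eq_left hR.le, h.zero]
  · have : Tendsto (fun s : ℝ => s + (α R - R)) atTop atTop :=
      tendsto_atTop_add_const_right _ _ tendsto_id
    refine tendsto_atTop_mono' _ ?_ this
    filter_upwards [eventually_ge_atTop R] with s hs
    rw [min_eq_right hs]
    linarith
  · intro s hs
    simp [min_eq_left hs]

lemma le_iterate_of_le {ρ : ℝ → ℝ} (h : ∀ s, s ≤ ρ s) (hm : Monotone ρ) {k l : ℕ} (hkl : k ≤ l)
    (s : ℝ) : ρ^[k] s ≤ ρ^[l] s :=
  Function.monotone_iterate_of_id_le (f := ρ) (fun s => h s) hkl s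

/-! ### Uniform stability -/

lemma stab_core {n : ℕ} {Γ : Type*} [TopologicalSpace Γ] [DecidableEq Γ]
    (f : Eucl n × Γ → Eucl n) (domf : Set (Eucl n × Γ))
    (V : Eucl n × Γ → ℝ) (domV : Set (Eucl n × Γ)) (x : ℝ → Eucl n) (σ : ℝ → Γ) (I : Set ℝ)
    (hI : Ici (0:ℝ) ⊆ I) (htr : IsTrajectory f domf x σ I)
    (hdec : ∀ a b : ℝ, 0 ≤ a → a ≤ b → (∀ t ∈ Icc a b, x t ∈ Oset domV) →
      ∀ γ : Γ, AntitoneOn (fun t => V (x t, γ)) (Icc a b ∩ {t | σ t = γ}))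
    (R : ℝ) (hRO : ∀ ξ : Eucl n, ‖ξ‖ < R → ξ ∈ Oset domV)
    (ρ : ℝ → ℝ) (hρm : StrictMono ρ) (hρ : ∀ s, s ≤ ρ s)
    (hcmp : ∀ γ : Γ, ∀ ξ ∈ Ogamma domV domf γ, ∀ η ∈ Ogamma domV domf γ,
      ‖ξ‖ < R → ‖η‖ < R → V (ξ, γ) ≤ V (η, γ) → ‖ξ‖ ≤ ρ ‖η‖)
    (t₀ : ℝ) (ht₀ : 0 ≤ t₀) (k : ℕ) :
    ∀ (S : Finset Γ), S.card = k → ∀ t, t₀ ≤ t → (∀ s ∈ Icc t₀ t, ‖x s‖ < R) →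
      (∀ s ∈ Ico t₀ t, σ s ∈ S) → ‖x t‖ ≤ ρ^[k] ‖x t₀‖ := by
  induction k with
  | zero =>
    intro S hS t ht _ hσ
    rcases ht.eq_or_lt with h | h
    · subst h; simp
    · have := hσ t₀ ⟨le_rfl, h⟩
      rw [Finset.card_eq_zero.1 hS] at this
      simp at this
  | succ k ih =>
    intro S hS t ht hx hσ
    rcases ht.eq_or_lt with h | h
    · subst h
      exact le_iterate_of_le hρ hρm.monotone (Nat.zero_le (k+1)) ‖x t₀‖
    obtain ⟨ε, hε, hleft⟩ := htr.signal.leftConst t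
    -- choose a point close to t on the left
    set m := max t₀ (t - ε) with hm
    have hmt : m < t := max_lt h (by linarith)
    set p := (m + t) / 2 with hp
    have hp1 : m < p := by rw [hp]; linarith
    have hp2 : p < t := by rw [hp]; linarith
    have hmt₀ : t₀ ≤ m := le_max_left _ _
    have hmε : t - ε ≤ m := le_max_right _ _
    set γ := σ p with hγ
    have hσγ : ∀ s ∈ Ioo m t, σ s = γ := fun s hs =>
      hleft s ⟨hmε.trans_lt hs.1, hs.2⟩ p ⟨hmε.trans_lt hp1, hp2⟩
    set A := {s | s ∈ Ico t₀ t ∧ σ s = γ} with hA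
    have hAne : A.Nonempty := ⟨p, ⟨(hmt₀.trans_lt hp1).le, hp2⟩, rfl⟩
    have hAbd : BddBelow A := ⟨t₀, fun s hs => hs.1.1⟩
    set τ := sInf A with hτ
    have hτ0 : t₀ ≤ τ := le_csInf hAne fun s hs => hs.1.1
    have hτp : τ ≤ p := csInf_le hAbd ⟨⟨(hmt₀.trans_lt hp1).le, hp2⟩, rfl⟩
    have hτγ : σ τ = γ := by
      obtain ⟨e, he, hr⟩ := htr.signal.rightConst τ
      obtain ⟨s, hs, hs'⟩ := exists_lt_of_csInf_lt hAne (show sInf A < τ + e by linarith)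
      rw [← hr s ⟨csInf_le hAbd hs, hs'⟩]
      exact hs.2
    have hτt : τ < t := hτp.trans_lt hp2
    have hγS : γ ∈ S := hσ p ⟨(hmt₀.trans_lt hp1).le, hp2⟩
    have h1 : ‖x τ‖ ≤ ρ^[k] ‖x t₀‖ := by
      refine ih (S.erase γ) (by rw [Finset.card_erase_of_mem hγS, hS]; rfl) τ hτ0
        (fun s hs => hx s ⟨hs.1, hs.2.trans hτt.le⟩) ?_
      intro s hs
      refine Finset.mem_erase.2 ⟨fun hc => ?_, hσ s ⟨hs.1, hs.2.trans hτt⟩⟩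
      exact absurd (csInf_le hAbd (show s ∈ A from ⟨⟨hs.1, hs.2.trans hτt⟩, hc⟩))
        (not_le.2 hs.2)
    have hO : ∀ s ∈ Icc t₀ t, x s ∈ Oset domV := fun s hs => hRO _ (hx s hs)
    have hmem : ∀ s ∈ Icc t₀ t, σ s = γ → x s ∈ Ogamma domV domf γ := by
      intro s hs hsγ
      refine ⟨hO s hs, ?_⟩
      rw [← hsγ]
      exact htr.mem s (hI (ht₀.trans hs.1))
    have h2 : ∀ s ∈ Ioo p t, ‖x s‖ ≤ ρ ‖x τ‖ := by
      intro s hs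
      have hsI : s ∈ Icc t₀ t := ⟨by linarith [hs.1], hs.2.le⟩
      have hτI : τ ∈ Icc t₀ t := ⟨hτ0, hτt.le⟩
      have hsγ : σ s = γ := hσγ s ⟨hp1.trans hs.1, hs.2⟩
      refine hcmp γ _ (hmem s hsI hsγ) _ (hmem τ hτI hτγ) (hx s hsI) (hx τ hτI) ?_
      exact hdec t₀ t ht₀ ht hO γ ⟨hτI, hτγ⟩ ⟨hsI, hsγ⟩ (hτp.trans hs.1.le)
    have h3 : ‖x t‖ ≤ ρ ‖x τ‖ := by
      have hc : ContinuousWithinAt x (Ioo p t) t :=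
        (htr.cont t (hI (ht₀.trans ht))).mono
          fun s hs => hI (show (0:ℝ) ≤ s by linarith [hs.1])
      have : (𝓝[Ioo p t] t).NeBot := by
        rw [nhdsWithin_Ioo_eq_nhdsLT hp2]; infer_instance
      exact le_of_tendsto hc.norm (eventually_nhdsWithin_of_forall h2)
    rw [Function.iterate_succ_apply']
    exact h3.trans (hρm.monotone h1)

lemma stab {n : ℕ} {Γ : Type*} [TopologicalSpace Γ] [Finite Γ]
    (f : Eucl n × Γ → Eucl n) (domf : Set (Eucl n × Γ))
    (V : Eucl n × Γ → ℝ) (domV : Set (Eucl n × Γ)) (x : ℝ → Eucl n) (σ : ℝ → Γ) (I : Set ℝ)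
    (hI : Ici (0:ℝ) ⊆ I) (htr : IsTrajectory f domf x σ I)
    (hdec : ∀ a b : ℝ, 0 ≤ a → a ≤ b → (∀ t ∈ Icc a b, x t ∈ Oset domV) →
      ∀ γ : Γ, AntitoneOn (fun t => V (x t, γ)) (Icc a b ∩ {t | σ t = γ}))
    (R : ℝ) (hRO : ∀ ξ : Eucl n, ‖ξ‖ < R → ξ ∈ Oset domV)
    (ρ : ℝ → ℝ) (hρm : StrictMono ρ) (hρ : ∀ s, s ≤ ρ s)
    (hcmp : ∀ γ : Γ, ∀ ξ ∈ Ogamma domV domf γ, ∀ η ∈ Ogamma domV domf γ,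
      ‖ξ‖ < R → ‖η‖ < R → V (ξ, γ) ≤ V (η, γ) → ‖ξ‖ ≤ ρ ‖η‖)
    (t₀ : ℝ) (ht₀ : 0 ≤ t₀) (hx0 : ρ^[Nat.card Γ] ‖x t₀‖ < R) (t : ℝ) (ht : t₀ ≤ t) :
    ‖x t‖ ≤ ρ^[Nat.card Γ] ‖x t₀‖ := by
  classical
  have := Fintype.ofFinite Γ
  have core : ∀ t, t₀ ≤ t → (∀ s ∈ Icc t₀ t, ‖x s‖ < R) → ‖x t‖ ≤ ρ^[Nat.card Γ] ‖x t₀‖ :=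
    fun t ht hx => stab_core f domf V domV x σ I hI htr hdec R hRO ρ hρm hρ hcmp t₀ ht₀
      (Nat.card Γ) Finset.univ (by simp) t ht hx (fun s _ => Finset.mem_univ _)
  refine core t ht ?_
  by_contra hcon
  push Not at hcon
  obtain ⟨s, hs, hsR⟩ := hcon
  have hcont : ContinuousOn x (Icc t₀ t) :=
    htr.cont.mono fun s hs => hI (ht₀.trans hs.1)
  set B := {s | s ∈ Icc t₀ t ∧ R ≤ ‖x s‖} with hB
  have hBc : IsCompact B := by
    have : B = Icc t₀ t ∩ (fun s => ‖x s‖) ⁻¹' Ici R := rfl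
    rw [this]
    exact isCompact_Icc.of_isClosed_subset
      (hcont.norm.preimage_isClosed_of_isClosed isClosed_Icc isClosed_Ici) inter_subset_left
  obtain ⟨u, hu, humin⟩ := hBc.exists_isLeast ⟨s, hs, hsR⟩
  have hlt : ∀ s ∈ Ico t₀ u, ‖x s‖ ≤ ρ^[Nat.card Γ] ‖x t₀‖ := by
    intro s hs
    refine core s hs.1 fun v hv => ?_
    by_contra hc
    have := humin (show v ∈ B from ⟨⟨hv.1, hv.2.trans (hs.2.le.trans hu.1.2)⟩, not_lt.1 hc⟩)
    linarith [hs.2, hv.2]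
  have hle : ‖x u‖ ≤ ρ^[Nat.card Γ] ‖x t₀‖ := by
    rcases hu.1.1.eq_or_lt with h | h
    · rw [← h]
      exact le_iterate_of_le hρ hρm.monotone (Nat.zero_le _) ‖x t₀‖
    · have hc : ContinuousWithinAt x (Ico t₀ u) u :=
        (hcont u hu.1).mono fun s hs => ⟨hs.1, hs.2.le.trans hu.1.2⟩
      have : (𝓝[Ico t₀ u] u).NeBot := by
        rw [nhdsWithin_Ico_eq_nhdsLT h]; infer_instance
      exact le_of_tendsto hc.norm (eventually_nhdsWithin_of_forall hlt)
  exact absurd (hu.2.trans hle) (not_le.2 hx0)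

/-! ### Convergence -/

/-- Arzelà–Ascoli for a sequence of uniformly Lipschitz functions. -/
lemma aa_seq {n : ℕ} {δ M R : ℝ} (hδ : 0 < δ) (hM : 0 ≤ M) (z : ℕ → ℝ → Eucl n)
    (hlip : ∀ k, ∀ s ∈ Icc 0 δ, ∀ t ∈ Icc 0 δ, ‖z k s - z k t‖ ≤ M * |s - t|)
    (hbd : ∀ k, ∀ s ∈ Icc 0 δ, ‖z k s‖ ≤ R) :
    ∃ y : ℝ → Eucl n, ∃ φ : ℕ → ℕ, Continuous y ∧ StrictMono φ ∧
      (∀ t ∈ Icc 0 δ, Tendsto (fun j => z (φ j) t) atTop (𝓝 (y t))) ∧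
      (∀ t, ∃ t' ∈ Icc 0 δ, y t = y t') := by
  have hl : ∀ k, LipschitzWith M.toNNReal (fun s : Icc (0:ℝ) δ => z k s) := by
    intro k
    refine LipschitzWith.of_dist_le_mul fun s t => ?_
    rw [dist_eq_norm, Real.coe_toNNReal _ hM, Subtype.dist_eq, Real.dist_eq]
    exact hlip k s s.2 t t.2
  let Z : ℕ → BoundedContinuousFunction (Icc (0:ℝ) δ) (Eucl n) := fun k =>
    BoundedContinuousFunction.mkOfCompact ⟨fun s => z k s, (hl k).continuous⟩
  have hZ : ∀ k s, Z k s = z k s := fun k s => rfl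
  have hcomp : IsCompact (closure (range Z)) := by
    refine BoundedContinuousFunction.arzela_ascoli (Metric.closedBall 0 R)
      (isCompact_closedBall _ _) _ ?_ ?_
    · rintro _ s ⟨k, rfl⟩
      rw [mem_closedBall_zero_iff]
      exact hbd k s s.2
    · refine (LipschitzWith.uniformEquicontinuous _ M.toNNReal ?_).equicontinuous
      rintro ⟨_, k, rfl⟩
      exact hl k
  obtain ⟨g, -, φ, hφ, hlim⟩ := hcomp.tendsto_subseq (x := Z) fun k => subset_closure ⟨k, rfl⟩
  refine ⟨fun t => g (projIcc 0 δ hδ.le t), φ, g.continuous.comp continuous_projIcc, hφ, ?_, ?_⟩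
  · intro t ht
    have h := (BoundedContinuousFunction.tendsto_iff_tendstoUniformly.1 hlim).tendsto_at
      (⟨t, ht⟩ : Icc (0:ℝ) δ)
    beta_reduce
    rw [projIcc_of_mem hδ.le ht]
    exact h
  · intro t
    refine ⟨projIcc 0 δ hδ.le t, (projIcc 0 δ hδ.le t).2, ?_⟩
    simp

/-- A solution along which `V` is constant consists of equilibria. -/
lemma limit_equil {n : ℕ} {Γ : Type*} [TopologicalSpace Γ]
    (f : Eucl n × Γ → Eucl n) (domf : Set (Eucl n × Γ)) (hf : ContinuousOn f domf)
    (V : Eucl n × Γ → ℝ) (domV : Set (Eucl n × Γ)) (W : Eucl n × Γ → ℝ)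
    (hV : ClassVFun V domV domf) (hW : Wineq f V W domV domf)
    (hobs : CondEquilObs f domf domV W) (γ : Γ) {δ : ℝ} (hδ : 0 < δ)
    (y : ℝ → Eucl n) (hy : Continuous y) (hmem : ∀ t, y t ∈ Ogamma domV domf γ)
    (hint : ∀ t ∈ Icc 0 δ, y t = y 0 + ∫ s in (0:ℝ)..t, f (y s, γ))
    (c : ℝ) (hc : ∀ t ∈ Icc 0 δ, V (y t, γ) = c) :
    ∀ t ∈ Icc 0 δ, f (y t, γ) = 0 := by
  have hG : Continuous fun s => f (y s, γ) :=
    hf.comp_continuous (hy.prodMk continuous_const) fun s => (hmem s).2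
  have hW0 : ∀ t ∈ Icc 0 δ, W (y t, γ) = 0 := by
    intro t ht
    have hd : HasDerivWithinAt y (f (y t, γ)) (Icc 0 δ) t := by
      have h1 : HasDerivWithinAt (fun u => y 0 + ∫ s in (0:ℝ)..u, f (y s, γ)) (f (y t, γ))
          (Icc 0 δ) t :=
        ((hG.integral_hasStrictDerivAt 0 t).hasDerivAt.const_add (y 0)).hasDerivWithinAt
      exact h1.congr hint (hint t ht)
    have h2 := (hV.diff γ (y t) (hmem t)).hasFDerivAt.comp_hasDerivWithinAt t hd
    have h3 : HasDerivWithinAt ((fun ξ' => V (ξ', γ)) ∘ y) 0 (Icc 0 δ) t :=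
      (hasDerivWithinAt_const t (Icc 0 δ) c).congr (fun s hs => hc s hs) (hc t ht)
    have h4 := (uniqueDiffOn_Icc hδ t ht).eq_deriv _ h2 h3
    have h5 := hW γ (y t) (hmem t)
    rw [h4] at h5
    linarith [h5.1, h5.2]
  have hsol : ∀ t ∈ Icc 0 δ, ∀ t' ∈ Icc 0 δ, y t' = y t + ∫ s in t..t', f (y s, γ) := by
    intro t ht t' ht'
    rw [hint t' ht', hint t ht, add_assoc, intervalIntegral.integral_add_adjacent_intervals
      (hG.intervalIntegrable _ _) (hG.intervalIntegrable _ _)]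
  have hshift : ∀ t (J : Set ℝ), (∀ s ∈ J, t + s ∈ Icc 0 δ) →
      IsSolOn (fun ξ => f (ξ, γ)) (Ogamma domV domf γ) (fun s => y (t + s)) J := by
    intro t J hJ
    refine ⟨(hy.comp (continuous_const.add continuous_id)).continuousOn, fun s _ => hmem _, ?_⟩
    intro a ha b hb
    refine ⟨(hG.comp (continuous_const.add continuous_id)).intervalIntegrable _ _, ?_⟩
    rw [intervalIntegral.integral_comp_add_left (fun s => f (y s, γ)) t]
    exact hsol _ (hJ a ha) _ (hJ b hb)
  have hopen : ∀ t ∈ Ioo 0 δ, f (y t, γ) = 0 := by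
    intro t ht
    rcases hobs γ with h | h
    · have : y t ∈ Egamma f domf γ ∩ Ogamma domV domf γ := by
        rw [← h]
        refine mem_iUnion₂.2 ⟨t, ht.1, fun s => y (t + s), hshift t _ ?_, by simp, ?_⟩
        · intro s hs; exact ⟨by linarith [hs.1], by linarith [hs.2, ht.2]⟩
        · intro s hs; exact hW0 _ ⟨by linarith [hs.1], by linarith [hs.2, ht.2]⟩
      exact this.1.2
    · have : y t ∈ Egamma f domf γ ∩ Ogamma domV domf γ := by
        rw [← h]
        refine mem_iUnion₂.2 ⟨δ - t, sub_pos.2 ht.2, fun s => y (t + s), hshift t _ ?_,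
          by simp, ?_⟩
        · intro s hs; exact ⟨by linarith [hs.1, ht.1], by linarith [hs.2]⟩
        · intro s hs; exact hW0 _ ⟨by linarith [hs.1, ht.1], by linarith [hs.2]⟩
      exact this.1.2
  have hcl : closure (Ioo 0 δ) ⊆ {t | f (y t, γ) = 0} :=
    closure_minimal hopen (isClosed_eq hG continuous_const)
  rw [closure_Ioo hδ.ne] at hcl
  exact hcl

/-- On long pieces of constancy the vector field tends to zero along the trajectory. -/
lemma piece_small {n : ℕ} {Γ : Type*} [TopologicalSpace Γ]
    (f : Eucl n × Γ → Eucl n) (domf : Set (Eucl n × Γ)) (hdomf : IsClosed domf)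
    (hf : ContinuousOn f domf)
    (V : Eucl n × Γ → ℝ) (domV : Set (Eucl n × Γ)) (W : Eucl n × Γ → ℝ)
    (hV : ClassVFun V domV domf) (hW : Wineq f V W domV domf)
    (hobs : CondEquilObs f domf domV W)
    (x : ℝ → Eucl n) (σ : ℝ → Γ) (I : Set ℝ)
    (hI : Ici (0:ℝ) ⊆ I) (htr : IsTrajectory f domf x σ I)
    (R M : ℝ) (hM : 0 ≤ M) (hRO : ∀ ξ : Eucl n, ‖ξ‖ ≤ R → ξ ∈ Oset domV)
    (hxR : ∀ t, 0 ≤ t → ‖x t‖ ≤ R) (hfM : ∀ t, 0 ≤ t → ‖f (x t, σ t)‖ ≤ M)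
    (γ : Γ) (c : ℝ)
    (hc : ∀ ε > 0, ∃ T0 : ℝ, ∀ t, T0 ≤ t → σ t = γ → |V (x t, γ) - c| < ε)
    {δ : ℝ} (hδ : 0 < δ) {ε : ℝ} (hε : 0 < ε) :
    ∃ T0 : ℝ, ∀ s, T0 ≤ s → (∀ u ∈ Icc s (s + δ), σ u = γ) →
      ‖f (x s, γ)‖ < ε ∧ ‖f (x (s + δ), γ)‖ < ε := by
  by_contra hcon
  push Not at hcon
  choose s hs hsγ hsbad using fun k : ℕ => hcon (k : ℝ)
  have hs0 : ∀ k, 0 ≤ s k := fun k => (Nat.cast_nonneg k).trans (hs k)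
  have hγ' : ∀ k, ∀ u ∈ Icc 0 δ, σ (s k + u) = γ := fun k u hu =>
    hsγ k _ ⟨by linarith [hu.1], by linarith [hu.2]⟩
  have hpos : ∀ k, ∀ u ∈ Icc 0 δ, 0 ≤ s k + u := fun k u hu => add_nonneg (hs0 k) hu.1
  have hdom : ∀ k, ∀ u ∈ Icc 0 δ, (x (s k + u), γ) ∈ domf := by
    intro k u hu
    rw [← hγ' k u hu]
    exact htr.mem _ (hI (hpos k u hu))
  have hinc : ∀ a b, 0 ≤ a → 0 ≤ b → ‖x a - x b‖ ≤ M * |a - b| := by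
    intro a b ha hb
    rw [(htr.intg b (hI hb) a (hI ha)).2, add_sub_cancel_left]
    refine intervalIntegral.norm_integral_le_of_norm_le_const fun u hu => hfM u ?_
    exact (le_min hb ha).trans hu.1.le
  obtain ⟨y, φ, hy, hφ, hlim, hrange⟩ := aa_seq hδ hM (fun k u => x (s k + u)) (R := R)
    (fun k a ha b hb => by
      have := hinc _ _ (hpos k a ha) (hpos k b hb)
      rwa [add_sub_add_left_eq_sub] at this)
    (fun k u hu => hxR _ (hpos k u hu))
  have hmem' : ∀ t ∈ Icc 0 δ, y t ∈ Ogamma domV domf γ := by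
    intro t ht
    constructor
    · refine hRO _ (le_of_tendsto (hlim t ht).norm (Eventually.of_forall fun j => ?_))
      exact hxR _ (hpos _ t ht)
    · exact hdomf.mem_of_tendsto ((hlim t ht).prodMk_nhds tendsto_const_nhds)
        (Eventually.of_forall fun j => hdom _ t ht)
  have hmem : ∀ t, y t ∈ Ogamma domV domf γ := by
    intro t
    obtain ⟨t', ht', h⟩ := hrange t
    rw [h]; exact hmem' t' ht'
  have hflim : ∀ t ∈ Icc 0 δ,
      Tendsto (fun j => f (x (s (φ j) + t), γ)) atTop (𝓝 (f (y t, γ))) := by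
    intro t ht
    have h1 : Tendsto (fun j => (x (s (φ j) + t), γ)) atTop (𝓝[domf] (y t, γ)) :=
      tendsto_nhdsWithin_iff.2 ⟨(hlim t ht).prodMk_nhds tendsto_const_nhds,
        Eventually.of_forall fun j => hdom _ t ht⟩
    exact (hf _ (hmem t).2).tendsto.comp h1
  have h0 : (0:ℝ) ∈ Icc 0 δ := ⟨le_rfl, hδ.le⟩
  have hsol : ∀ k, ∀ t ∈ Icc 0 δ,
      x (s k + t) = x (s k + 0) + ∫ u in (0:ℝ)..t, f (x (s k + u), γ) := by
    intro k t ht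
    rw [(htr.intg _ (hI (hpos k 0 h0)) _ (hI (hpos k t ht))).2,
      ← intervalIntegral.integral_comp_add_left (fun u => f (x u, σ u)) (s k)]
    congr 1
    refine intervalIntegral.integral_congr fun u hu => ?_
    rw [uIcc_of_le ht.1] at hu
    rw [hγ' k u ⟨hu.1, hu.2.trans ht.2⟩]
  have hint : ∀ t ∈ Icc 0 δ, y t = y 0 + ∫ u in (0:ℝ)..t, f (y u, γ) := by
    intro t ht
    have hsub : uIoc 0 t ⊆ Icc 0 δ := by
      rw [uIoc_of_le ht.1]
      exact fun u hu => ⟨hu.1.le, hu.2.trans ht.2⟩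
    have h1 : Tendsto (fun j => ∫ u in (0:ℝ)..t, f (x (s (φ j) + u), γ)) atTop
        (𝓝 (∫ u in (0:ℝ)..t, f (y u, γ))) := by
      refine intervalIntegral.tendsto_integral_filter_of_dominated_convergence (fun _ => M)
        (Eventually.of_forall fun j => ?_) (Eventually.of_forall fun j => ?_)
        intervalIntegrable_const (Eventually.of_forall fun u hu => hflim u (hsub hu))
      · refine ContinuousOn.aestronglyMeasurable ?_ measurableSet_uIoc
        refine hf.comp (t := domf) (ContinuousOn.prodMk ?_ continuousOn_const)
          fun u hu => hdom _ u (hsub hu)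
        refine htr.cont.comp (continuous_const.add continuous_id).continuousOn ?_
        exact fun u hu => hI (hpos _ u (hsub hu))
      · refine Eventually.of_forall fun u hu => ?_
        have := hfM _ (hpos (φ j) u (hsub hu))
        rwa [hγ' (φ j) u (hsub hu)] at this
    have h2 := (hlim 0 h0).add h1
    refine tendsto_nhds_unique (hlim t ht) (h2.congr fun j => ?_)
    exact (hsol (φ j) t ht).symm
  have hsφ : Tendsto (fun j => s (φ j)) atTop atTop := by
    have h1 : Tendsto s atTop atTop := tendsto_atTop_mono hs tendsto_natCast_atTop_atTop
    exact h1.comp hφ.tendsto_atTop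
  have hVc : ∀ t ∈ Icc 0 δ, V (y t, γ) = c := by
    intro t ht
    have h1 : Tendsto (fun j => V (x (s (φ j) + t), γ)) atTop (𝓝 (V (y t, γ))) :=
      (hV.diff γ (y t) (hmem t)).continuousAt.tendsto.comp (hlim t ht)
    refine tendsto_nhds_unique h1 (Metric.tendsto_atTop'.2 fun e he => ?_)
    obtain ⟨T0, hT0⟩ := hc e he
    obtain ⟨N, hN⟩ := eventually_atTop.1 (hsφ.eventually_ge_atTop T0)
    refine ⟨N, fun j hj => ?_⟩
    rw [Real.dist_eq]
    exact hT0 _ (by linarith [hN j hj.le, ht.1]) (hγ' _ t ht)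
  have heq := limit_equil f domf hf V domV W hV hW hobs γ hδ y hy hmem hint c hVc
  have ha := hflim 0 h0
  have hb := hflim δ ⟨hδ.le, le_rfl⟩
  rw [heq 0 h0] at ha
  rw [heq δ ⟨hδ.le, le_rfl⟩] at hb
  have ha' := ha.norm.eventually_lt_const (by simpa using hε)
  have hb' := hb.norm.eventually_lt_const (by simpa using hε)
  obtain ⟨j, hj1, hj2⟩ := (ha'.and hb').exists
  rw [add_zero] at hj1
  exact absurd hj2 (not_lt.2 (hsbad (φ j) hj1))

/-- A signal without jumps in `(a,b]` is constant on `[a,b]`. -/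
lemma const_of_no_jump {Γ : Type*} [TopologicalSpace Γ] [DiscreteTopology Γ] {σ : ℝ → Γ}
    (hσ : IsSwitchingSignal σ) {a b : ℝ} (h : ∀ t ∈ Ioc a b, t ∉ JumpTimes σ) :
    ∀ s ∈ Icc a b, ∀ t ∈ Icc a b, σ s = σ t := by
  intro s hs t ht
  refine isPreconnected_Icc.constant (f := σ) (s := Icc a b) ?_ hs ht
  intro u hu
  rcases hu.1.eq_or_lt with h1 | h1
  · subst h1
    obtain ⟨e, he, hr⟩ := hσ.rightConst a
    have : ∀ᶠ v in 𝓝[Icc a b] a, σ v = σ a := by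
      have h2 : Iio (a + e) ∈ 𝓝[Icc a b] a :=
        mem_nhdsWithin_of_mem_nhds (Iio_mem_nhds (by linarith))
      filter_upwards [h2, self_mem_nhdsWithin] with v hv hv'
      exact hr v ⟨hv'.1, hv⟩
    exact tendsto_const_nhds.congr' (this.mono fun v hv => hv.symm)
  · have := h u ⟨h1, hu.2⟩
    exact (not_not.1 this).continuousWithinAt

lemma dwell_dichotomy {Γ : Type*} [TopologicalSpace Γ] [DiscreteTopology Γ] {σ : ℝ → Γ}
    {τD : ℝ} (hτ : 0 < τD) (hσ : σ ∈ SD Γ τD) (t : ℝ) :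
    (∀ u ∈ Icc (t - τD / 4) t, σ u = σ t) ∨ (∀ u ∈ Icc t (t + τD / 4), σ u = σ t) := by
  by_cases h1 : ∀ u ∈ Ioc (t - τD / 4) t, u ∉ JumpTimes σ
  · left
    intro u hu
    exact const_of_no_jump hσ.1 h1 u hu t ⟨by linarith, le_rfl⟩
  by_cases h2 : ∀ u ∈ Ioc t (t + τD / 4), u ∉ JumpTimes σ
  · right
    intro u hu
    exact const_of_no_jump hσ.1 h2 u hu t ⟨le_rfl, by linarith⟩
  exfalso
  push Not at h1 h2
  obtain ⟨a, ha, haj⟩ := h1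
  obtain ⟨b, hb, hbj⟩ := h2
  have hle := hσ.2 (t - τD / 4) (t + τD / 2) (by linarith)
  have hfin : (JumpTimes σ ∩ Ioo (t - τD / 4) (t + τD / 2)).Finite :=
    (hσ.1.locFinite (t - τD / 4) (t + τD / 2)).subset
      (inter_subset_inter_right _ Ioo_subset_Icc_self)
  have hcard := (one_lt_ncard hfin).2 ⟨a, ⟨haj, ha.1, by linarith [ha.2]⟩, b,
    ⟨hbj, by linarith [hb.1], by linarith [hb.2]⟩, (ha.2.trans_lt hb.1).ne⟩
  have h3 : (2:ℝ) ≤ ((JumpTimes σ ∩ Ioo (t - τD / 4) (t + τD / 2)).ncard : ℝ) := by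
    exact_mod_cast hcard
  have h4 : (t + τD / 2 - (t - τD / 4)) / τD = 3 / 4 := by field_simp; ring
  rw [h4] at hle
  norm_num at hle
  linarith

lemma conv_zero {n : ℕ} {Γ : Type*} [MetricSpace Γ] [Finite Γ]
    (f : Eucl n × Γ → Eucl n) (domf : Set (Eucl n × Γ)) (hdomf : IsClosed domf)
    (hf : ContinuousOn f domf)
    (V : Eucl n × Γ → ℝ) (domV : Set (Eucl n × Γ)) (W : Eucl n × Γ → ℝ)
    (hV : ClassVFun V domV domf) (hW : Wineq f V W domV domf)
    (hVnn : ∀ γ : Γ, ∀ ξ ∈ Ogamma domV domf γ, 0 ≤ V (ξ, γ))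
    (hobs : CondEquilObs f domf domV W)
    (hcap : (⋂ γ : Γ, Egamma f domf γ ∩ Ogamma domV domf γ) = {0})
    (x : ℝ → Eucl n) (σ : ℝ → Γ) (I : Set ℝ)
    (hI : Ici (0:ℝ) ⊆ I) (htr : IsTrajectory f domf x σ I)
    (hσ : σ ∈ SEall Γ ∩ SDall Γ)
    (hdec : ∀ a b : ℝ, 0 ≤ a → a ≤ b → (∀ t ∈ Icc a b, x t ∈ Oset domV) →
      ∀ γ : Γ, AntitoneOn (fun t => V (x t, γ)) (Icc a b ∩ {t | σ t = γ}))
    (R : ℝ) (hRO : ∀ ξ : Eucl n, ‖ξ‖ ≤ R → ξ ∈ Oset domV)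
    (hxR : ∀ t, 0 ≤ t → ‖x t‖ ≤ R) :
    Tendsto x atTop (𝓝 0) := by
  obtain ⟨hσe, hσd⟩ := hσ
  obtain ⟨Te, hTe, hσe⟩ := mem_iUnion₂.1 hσe
  obtain ⟨τD, hτ, hσd⟩ := mem_iUnion₂.1 hσd
  have hTe : 0 < Te := hTe
  have hτ : 0 < τD := hτ
  -- bound for the vector field
  obtain ⟨M, hM, hfM⟩ : ∃ M, 0 ≤ M ∧ ∀ t, 0 ≤ t → ‖f (x t, σ t)‖ ≤ M := by
    have hK : IsCompact ((Metric.closedBall (0 : Eucl n) R ×ˢ (univ : Set Γ)) ∩ domf) :=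
      ((isCompact_closedBall _ _).prod finite_univ.isCompact).inter_right hdomf
    obtain ⟨C, hC⟩ := hK.exists_bound_of_continuousOn (hf.mono inter_subset_right)
    have hb : ∀ t, 0 ≤ t → ‖f (x t, σ t)‖ ≤ C := fun t ht =>
      hC _ ⟨⟨mem_closedBall_zero_iff.2 (hxR t ht), mem_univ _⟩, htr.mem t (hI ht)⟩
    exact ⟨C, (norm_nonneg _).trans (hb 0 le_rfl), hb⟩
  have hxO : ∀ t, 0 ≤ t → x t ∈ Oset domV := fun t ht => hRO _ (hxR t ht)
  have hxOg : ∀ t, 0 ≤ t → x t ∈ Ogamma domV domf (σ t) := fun t ht =>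
    ⟨hxO t ht, htr.mem t (hI ht)⟩
  -- limits of the Lyapunov functions
  have hlimV : ∀ γ : Γ, ∃ c : ℝ, ∀ ε > 0, ∃ T0 : ℝ, ∀ t, T0 ≤ t → σ t = γ →
      |V (x t, γ) - c| < ε := by
    intro γ
    set A := (fun t => V (x t, γ)) '' {t | 0 ≤ t ∧ σ t = γ} with hA
    have hbd : BddBelow A := by
      refine ⟨0, ?_⟩
      rintro _ ⟨t, ⟨ht, htγ⟩, rfl⟩
      have := hxOg t ht
      rw [htγ] at this
      exact hVnn γ _ this
    have hne : A.Nonempty := by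
      obtain ⟨t, ht, htγ⟩ := hσe 0 le_rfl γ
      exact ⟨_, t, ⟨ht.1, htγ⟩, rfl⟩
    refine ⟨sInf A, fun ε hε => ?_⟩
    obtain ⟨_, ⟨t₁, ⟨ht₁, ht₁γ⟩, rfl⟩, hlt⟩ :=
      exists_lt_of_csInf_lt hne (show sInf A < sInf A + ε by linarith)
    refine ⟨t₁, fun t ht htγ => ?_⟩
    have h1 : sInf A ≤ V (x t, γ) := csInf_le hbd ⟨t, ⟨ht₁.trans ht, htγ⟩, rfl⟩
    have h2 : V (x t, γ) ≤ V (x t₁, γ) :=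
      hdec t₁ t ht₁ ht (fun s hs => hxO s (ht₁.trans hs.1)) γ ⟨⟨le_rfl, ht⟩, ht₁γ⟩
        ⟨⟨ht, le_rfl⟩, htγ⟩ ht
    simp only at hlt
    rw [abs_lt]
    constructor <;> linarith
  -- the velocity tends to zero
  have hvel : ∀ ε > 0, ∃ T0 : ℝ, 0 ≤ T0 ∧ ∀ t, T0 ≤ t → ‖f (x t, σ t)‖ < ε := by
    intro ε hε
    have hδ : 0 < τD / 4 := by linarith
    have hex : ∀ γ : Γ, ∃ T0 : ℝ, ∀ s, T0 ≤ s → (∀ u ∈ Icc s (s + τD / 4), σ u = γ) →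
        ‖f (x s, γ)‖ < ε ∧ ‖f (x (s + τD / 4), γ)‖ < ε := by
      intro γ
      obtain ⟨c, hc⟩ := hlimV γ
      exact piece_small f domf hdomf hf V domV W hV hW hobs x σ I hI htr R M hM hRO hxR hfM
        γ c hc hδ hε
    choose T0 hT0 using hex
    obtain ⟨B, hB⟩ := (finite_range T0).bddAbove
    refine ⟨max 0 B + τD / 4, by positivity, fun t ht => ?_⟩
    have hBγ : ∀ γ, T0 γ ≤ B := fun γ => hB ⟨γ, rfl⟩
    have hBt : B ≤ max 0 B := le_max_right _ _
    rcases dwell_dichotomy hτ hσd t with h | h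
    · have := (hT0 (σ t) (t - τD / 4) (by linarith [hBγ (σ t)]) (by
        rw [sub_add_cancel]; exact h)).2
      rwa [sub_add_cancel] at this
    · exact (hT0 (σ t) t (by linarith [hBγ (σ t)]) h).1
  -- conclusion
  by_contra hcon
  rw [Metric.tendsto_atTop] at hcon
  push Not at hcon
  obtain ⟨ε, hε, hbad⟩ := hcon
  choose t ht htbad using fun k : ℕ => hbad (k : ℝ)
  have ht0 : ∀ k, 0 ≤ t k := fun k => (Nat.cast_nonneg k).trans (ht k)
  obtain ⟨ξ, hξR, φ, hφ, hlim⟩ := (isCompact_closedBall (0 : Eucl n) R).tendsto_subseq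
    (x := fun k => x (t k)) fun k => mem_closedBall_zero_iff.2 (hxR _ (ht0 k))
  have htφ : Tendsto (fun j => t (φ j)) atTop atTop :=
    (tendsto_atTop_mono ht tendsto_natCast_atTop_atTop).comp hφ.tendsto_atTop
  have hξ0 : ξ ∈ (⋂ γ : Γ, Egamma f domf γ ∩ Ogamma domV domf γ) := by
    refine mem_iInter.2 fun γ => ?_
    choose u hu huγ using fun j => hσe (t (φ j)) (ht0 _) γ
    have hu0 : ∀ j, 0 ≤ u j := fun j => (ht0 _).trans (hu j).1
    have hdiff : Tendsto (fun j => x (u j) - x (t (φ j))) atTop (𝓝 0) := by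
      refine Metric.tendsto_atTop.2 fun e he => ?_
      obtain ⟨T0, hT00, hT0⟩ := hvel (e / (2 * Te)) (by positivity)
      obtain ⟨N, hN⟩ := eventually_atTop.1 (htφ.eventually_ge_atTop T0)
      refine ⟨N, fun j hj => ?_⟩
      rw [dist_zero_right, (htr.intg _ (hI (ht0 (φ j))) _ (hI (hu0 j))).2, add_sub_cancel_left]
      have h1 := intervalIntegral.norm_integral_le_of_norm_le_const
        (f := fun s => f (x s, σ s)) (a := t (φ j)) (b := u j) (C := e / (2 * Te))
        fun s hs => by
          rw [uIoc_of_le (hu j).1] at hs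
          exact (hT0 s ((hN j hj).trans hs.1.le)).le
      refine h1.trans_lt ?_
      have h2 : |u j - t (φ j)| ≤ Te := by
        rw [abs_of_nonneg (by linarith [(hu j).1])]; linarith [(hu j).2]
      calc e / (2 * Te) * |u j - t (φ j)| ≤ e / (2 * Te) * Te := by gcongr
        _ = e / 2 := by field_simp
        _ < e := by linarith
    have hxu : Tendsto (fun j => x (u j)) atTop (𝓝 ξ) := by
      have := hdiff.add hlim
      simpa using this
    have hutop : Tendsto u atTop atTop := tendsto_atTop_mono (fun j => (hu j).1) htφ
    have hdom : ∀ j, (x (u j), γ) ∈ domf := by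
      intro j
      rw [← huγ j]
      exact htr.mem _ (hI (hu0 j))
    have hp : Tendsto (fun j => (x (u j), γ)) atTop (𝓝 (ξ, γ)) :=
      hxu.prodMk_nhds tendsto_const_nhds
    have hξdom : (ξ, γ) ∈ domf := hdomf.mem_of_tendsto hp (Eventually.of_forall hdom)
    have hfl : Tendsto (fun j => f (x (u j), γ)) atTop (𝓝 (f (ξ, γ))) :=
      (hf _ hξdom).tendsto.comp (tendsto_nhdsWithin_iff.2 ⟨hp, Eventually.of_forall hdom⟩)
    have hfl0 : Tendsto (fun j => f (x (u j), γ)) atTop (𝓝 0) := by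
      refine Metric.tendsto_atTop.2 fun e he => ?_
      obtain ⟨T0, -, hT0⟩ := hvel e he
      obtain ⟨N, hN⟩ := eventually_atTop.1 (hutop.eventually_ge_atTop T0)
      refine ⟨N, fun j hj => ?_⟩
      rw [dist_zero_right]
      have := hT0 _ (hN j hj)
      rwa [huγ j] at this
    exact ⟨⟨hξdom, tendsto_nhds_unique hfl hfl0⟩, hRO _ (mem_closedBall_zero_iff.1 hξR), hξdom⟩
  rw [hcap, mem_singleton_iff] at hξ0
  subst hξ0
  have h1 : ε ≤ ‖(0 : Eucl n)‖ := by
    refine ge_of_tendsto hlim.norm (Eventually.of_forall fun j => ?_)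
    have := htbad (φ j)
    rwa [dist_zero_right] at this
  rw [norm_zero] at h1
  linarith

/-- Iterates of the comparison function are of class K∞. -/
lemma iterate_classKInf {ρ : ℝ → ℝ} (hm : StrictMono ρ) (hc : Continuous ρ) (h0 : ρ 0 = 0)
    (hid : ∀ s, s ≤ ρ s) (N : ℕ) : ClassKInf (ρ^[N]) := by
  refine ⟨⟨(hc.iterate N).continuousOn, (hm.iterate N).strictMonoOn _,
    Function.iterate_fixed h0 N⟩, ?_⟩
  exact tendsto_atTop_mono (fun s => le_iterate_of_le hid hm.monotone (Nat.zero_le N) s)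
    tendsto_id

noncomputable section
theorem stability_criterion_ergodic
    {n : ℕ} {Γ : Type*} [MetricSpace Γ] [Finite Γ]
    (f : Eucl n × Γ → Eucl n) (domf : Set (Eucl n × Γ))
    (hdomf : IsClosed domf) (hf : ContinuousOn f domf)
    (T : Set ((ℝ → Eucl n) × (ℝ → Γ)))
    (hT : ForwardCompleteFamily f domf T)
    (hTσ : ∀ xs ∈ T, xs.2 ∈ SEall Γ ∩ SDall Γ)
    (V : Eucl n × Γ → ℝ) (domV : Set (Eucl n × Γ)) (W : Eucl n × Γ → ℝ)
    (hpair : FWeakLyapunovPair f domf V domV W T)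
    (hobs : CondEquilObs f domf domV W)
    (hcap : (⋂ γ : Γ, Egamma f domf γ ∩ Ogamma domV domf γ) = {0}) :
    FamilyLAS T ∧
    (Oset domV = Set.univ → RadiallyUnbounded V domV domf → FamilyGAS T) := by
  have hdec : ∀ xs ∈ T, ∀ a b : ℝ, 0 ≤ a → a ≤ b → (∀ t ∈ Icc a b, xs.1 t ∈ Oset domV) →
      ∀ γ : Γ, AntitoneOn (fun t => V (xs.1 t, γ)) (Icc a b ∩ {t | xs.2 t = γ}) :=
    hpair.decreasing
  obtain ⟨α₁, α₂, hα₁, hα₂, hbounds⟩ := hpair.bounds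
  have hVnn : ∀ γ : Γ, ∀ ξ ∈ Ogamma domV domf γ, 0 ≤ V (ξ, γ) := fun γ ξ hξ =>
    (hα₁.nonneg (norm_nonneg ξ)).trans (hbounds γ ξ hξ).1
  constructor
  · have hOopen : IsOpen (Oset domV) := by
      have : Oset domV = ⋃ γ : Γ, {ξ : Eucl n | (ξ, γ) ∈ domV} := by
        ext ξ
        simp [Oset]
      rw [this]
      exact isOpen_iUnion hpair.classV.openD
    obtain ⟨R, hR, hball⟩ := Metric.isOpen_iff.1 hOopen 0 hpair.zeroMem
    have hRO : ∀ ξ : Eucl n, ‖ξ‖ < R → ξ ∈ Oset domV := fun ξ hξ =>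
      hball (mem_ball_zero_iff.2 hξ)
    obtain ⟨β, hβ, hβα⟩ := exists_extension hα₁ hR
    obtain ⟨ρ, hm, hc, h0, hid, hρ⟩ := exists_rho hβ hα₂
    have hcmp : ∀ γ : Γ, ∀ ξ ∈ Ogamma domV domf γ, ∀ η ∈ Ogamma domV domf γ,
        ‖ξ‖ < R → ‖η‖ < R → V (ξ, γ) ≤ V (η, γ) → ‖ξ‖ ≤ ρ ‖η‖ := by
      intro γ ξ hξ η hη hξR _ hle
      refine hρ _ _ (norm_nonneg _) (norm_nonneg _) ?_
      rw [hβα _ hξR.le]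
      exact (hbounds γ ξ hξ).1.trans (hle.trans (hbounds γ η hη).2)
    have hK := iterate_classKInf hm hc h0 hid (Nat.card Γ)
    obtain ⟨r, hr, hrR⟩ : ∃ r > 0, ρ^[Nat.card Γ] r < R := by
      have h1 : ∀ᶠ s in 𝓝 (0:ℝ), ρ^[Nat.card Γ] s < R :=
        (hc.iterate _).continuousAt.eventually_lt_const (by rw [hK.zero]; exact hR)
      have h2 : ∀ᶠ s in 𝓝[>] (0:ℝ), ρ^[Nat.card Γ] s < R ∧ 0 < s :=
        (h1.filter_mono nhdsWithin_le_nhds).and self_mem_nhdsWithin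
      obtain ⟨s, hs⟩ := h2.exists
      exact ⟨s, hs.2, hs.1⟩
    have hst : ∀ xs ∈ T, ∀ t₀ : ℝ, 0 ≤ t₀ → ‖xs.1 t₀‖ ≤ r → ∀ t : ℝ, t₀ ≤ t →
        ‖xs.1 t‖ ≤ ρ^[Nat.card Γ] ‖xs.1 t₀‖ := by
      intro xs hxs t₀ ht₀ hx t ht
      obtain ⟨I, hI, htr⟩ := hT xs hxs
      exact stab f domf V domV xs.1 xs.2 I hI htr (hdec xs hxs) R hRO ρ hm hid hcmp t₀ ht₀
        (((hm.iterate _).monotone hx).trans_lt hrR) t ht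
    refine ⟨⟨r, hr, _, hK.toClassK, hst⟩, r, hr, fun xs hxs hx => ?_⟩
    obtain ⟨I, hI, htr⟩ := hT xs hxs
    refine conv_zero f domf hdomf hf V domV W hpair.classV hpair.wineq hVnn hobs hcap
      xs.1 xs.2 I hI htr (hTσ xs hxs) (hdec xs hxs) (ρ^[Nat.card Γ] r)
      (fun ξ hξ => hRO ξ (hξ.trans_lt hrR)) ?_
    intro t ht
    exact (hst xs hxs 0 le_rfl hx.le t ht).trans ((hm.iterate _).monotone hx.le)
  · intro hO hrad
    obtain ⟨β₁, β₂, hβ₁, hβ₂, hb⟩ := hrad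
    have hRO : ∀ ξ : Eucl n, ξ ∈ Oset domV := fun ξ => by rw [hO]; trivial
    obtain ⟨ρ, hm, hc, h0, hid, hρ⟩ := exists_rho hβ₁ hβ₂.toClassK
    have hK := iterate_classKInf hm hc h0 hid (Nat.card Γ)
    have hst : ∀ xs ∈ T, ∀ t₀ : ℝ, 0 ≤ t₀ → ∀ t : ℝ, t₀ ≤ t →
        ‖xs.1 t‖ ≤ ρ^[Nat.card Γ] ‖xs.1 t₀‖ := by
      intro xs hxs t₀ ht₀ t ht
      obtain ⟨I, hI, htr⟩ := hT xs hxs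
      refine stab f domf V domV xs.1 xs.2 I hI htr (hdec xs hxs)
        (ρ^[Nat.card Γ] ‖xs.1 t₀‖ + 1) (fun ξ _ => hRO ξ) ρ hm hid ?_ t₀ ht₀
        (lt_add_one _) t ht
      intro γ ξ hξ η hη _ _ hle
      exact hρ _ _ (norm_nonneg _) (norm_nonneg _)
        ((hb γ ξ hξ).1.trans (hle.trans (hb γ η hη).2))
    refine ⟨⟨_, hK, hst⟩, fun xs hxs => ?_⟩
    obtain ⟨I, hI, htr⟩ := hT xs hxs
    exact conv_zero f domf hdomf hf V domV W hpair.classV hpair.wineq hVnn hobs hcap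
      xs.1 xs.2 I hI htr (hTσ xs hxs) (hdec xs hxs) (ρ^[Nat.card Γ] ‖xs.1 0‖)
      (fun ξ _ => hRO ξ) (fun t ht => hst xs hxs 0 le_rfl t ht)
end
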